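/- arXiv:1808.09165 — 2 statements merged into one kernel-verified Lean document; each statement's English description precedes it below -/
import Mathlib

section
/- Let S = {v₁,…,vₙ} be an (n,k)-uframe with n > k and suppose for some index i the vector vᵢ lies in the convex hull of {±vⱼ : j ≠ i} (in particular the vectors {vⱼ : j ≠ i} span ℝᵏ). Let S̃ be the (n,k)-frame obtained from S by replacing vᵢ with 0, and let S' = B_{S̃}S̃ = {B_{S̃}ṽ₁,…,B_{S̃}ṽₙ}. Then vol(conv{±v₁,…,±vₙ}) ≤ vol(conv{±B_{S̃}ṽ₁,…,±B_{S̃}ṽₙ}), with equality if and only if vᵢ = 0. -/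
open MeasureTheory
open scoped RealInnerProductSpace ENNReal

/-- The operator `A_S = ∑ᵢ vᵢ ⊗ vᵢ` generated by a family of vectors in `ℝᵏ`. -/
noncomputable def frameOp {n k : ℕ} (v : Fin n → EuclideanSpace ℝ (Fin k)) :
    EuclideanSpace ℝ (Fin k) →ₗ[ℝ] EuclideanSpace ℝ (Fin k) :=
  ∑ i, LinearMap.smulRight (innerₛₗ ℝ (v i)) (v i)

/-- `S` is an `(n,k)`-uframe: `∑ᵢ vᵢ ⊗ vᵢ = I_k`. -/
def IsUframe {n k : ℕ} (v : Fin n → EuclideanSpace ℝ (Fin k)) : Prop :=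
  ∀ x : EuclideanSpace ℝ (Fin k), ∑ i, ⟪v i, x⟫ • v i = x

/-- `F(S)`: the volume of the convex hull of `{±v₁,…,±vₙ}` in `ℝᵏ`. -/
noncomputable def Fvol {n k : ℕ} (v : Fin n → EuclideanSpace ℝ (Fin k)) : ℝ≥0∞ :=
  volume (convexHull ℝ (Set.range v ∪ Set.range fun i => -v i))

theorem frameOp_apply {n k : ℕ} (v : Fin n → EuclideanSpace ℝ (Fin k))
    (x : EuclideanSpace ℝ (Fin k)) : frameOp v x = ∑ j, ⟪v j, x⟫ • v j := by
  simp [frameOp]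

theorem IsUframe.frameOp_update_zero {n k : ℕ} {v : Fin n → EuclideanSpace ℝ (Fin k)}
    (hv : IsUframe v) (i : Fin n) :
    frameOp (Function.update v i 0) = LinearMap.transvection (innerₛₗ ℝ (v i)) (-v i) := by
  ext1 x
  have h := hv x
  rw [← Finset.add_sum_erase _ _ (Finset.mem_univ i)] at h
  rw [frameOp_apply, ← Finset.add_sum_erase _ _ (Finset.mem_univ i),
    Finset.sum_congr rfl fun j hj ↦ by
      rw [Function.update_of_ne (Finset.ne_of_mem_erase hj)]]
  simp only [Function.update_self, smul_zero, zero_add, LinearMap.transvection.apply,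
    innerₛₗ_apply_apply, smul_neg]
  exact eq_add_neg_of_add_eq (by rw [add_comm]; exact h)

theorem Fvol_comp_linearMap {n k : ℕ} (v : Fin n → EuclideanSpace ℝ (Fin k))
    (B : EuclideanSpace ℝ (Fin k) →ₗ[ℝ] EuclideanSpace ℝ (Fin k)) :
    Fvol (fun j ↦ B (v j)) = ENNReal.ofReal |LinearMap.det B| * Fvol v := by
  rw [Fvol, Fvol, ← Measure.addHaar_image_linearMap, LinearMap.image_convexHull, Set.image_union,
    ← Set.range_comp, ← Set.range_comp]
  simp [Function.comp_def]

theorem Fvol_ne_top {n k : ℕ} (v : Fin n → EuclideanSpace ℝ (Fin k)) : Fvol v ≠ ∞ :=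
  (((Set.finite_range v).union (Set.finite_range _)).isCompact_convexHull ℝ).measure_ne_top

theorem IsUframe.Fvol_ne_zero {n k : ℕ} {v : Fin n → EuclideanSpace ℝ (Fin k)}
    (hv : IsUframe v) (i : Fin n) : Fvol v ≠ 0 := by
  have hne : (Set.range v ∪ Set.range fun j ↦ -v j).Nonempty := ⟨v i, Or.inl ⟨i, rfl⟩⟩
  refine (Measure.measure_pos_of_nonempty_interior volume
    (interior_convexHull_nonempty_iff_affineSpan_eq_top.2 ?_)).ne'
  rw [AffineSubspace.affineSpan_eq_top_iff_vectorSpan_eq_top_of_nonempty ℝ _ _ hne,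
    Submodule.eq_top_iff']
  intro x
  rw [← hv x]
  refine Submodule.sum_mem _ fun j _ ↦ Submodule.smul_mem _ _ ?_
  have h : v j -ᵥ (-v j) ∈ vectorSpan ℝ (Set.range v ∪ Set.range fun j ↦ -v j) :=
    vsub_mem_vectorSpan ℝ (Or.inl ⟨j, rfl⟩) (Or.inr ⟨j, rfl⟩)
  rw [vsub_eq_sub, sub_neg_eq_add, ← two_smul ℝ] at h
  exact (Submodule.smul_mem_iff _ two_ne_zero).1 h

theorem Fvol_update_zero {n k : ℕ} {v : Fin n → EuclideanSpace ℝ (Fin k)} {i : Fin n}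
    (hi : v i ∈ convexHull ℝ {y | ∃ j, j ≠ i ∧ (y = v j ∨ y = -v j)}) :
    Fvol (Function.update v i 0) = Fvol v := by
  set s := {y | ∃ j, j ≠ i ∧ (y = v j ∨ y = -v j)} with hs
  have hneg : -s = s := by
    ext y
    refine exists_congr fun j ↦ and_congr_right fun _ ↦ ?_
    rw [neg_inj, neg_eq_iff_eq_neg, or_comm]
  have hi' : -v i ∈ convexHull ℝ s := by
    rw [← hneg, convexHull_neg]
    exact Set.neg_mem_neg.2 hi
  have h0 : (0 : EuclideanSpace ℝ (Fin k)) ∈ convexHull ℝ s := by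
    simpa using (convex_convexHull ℝ s).midpoint_mem hi hi'
  have hull (w : Fin n → EuclideanSpace ℝ (Fin k)) (hw : ∀ j, j ≠ i → w j = v j)
      (h : w i ∈ convexHull ℝ s) (h' : -w i ∈ convexHull ℝ s) :
      convexHull ℝ (Set.range w ∪ Set.range fun j ↦ -w j) = convexHull ℝ s := by
    apply subset_antisymm
    · refine convexHull_min ?_ (convex_convexHull ℝ s)
      rintro _ (⟨j, rfl⟩ | ⟨j, rfl⟩) <;> rcases eq_or_ne j i with rfl | hj
      · exact h
      · exact subset_convexHull ℝ s ⟨j, hj, Or.inl (hw j hj)⟩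
      · exact h'
      · exact subset_convexHull ℝ s ⟨j, hj, Or.inr (congrArg _ (hw j hj))⟩
    · apply convexHull_mono
      rintro _ ⟨j, hj, rfl | rfl⟩
      · exact Or.inl ⟨j, hw j hj⟩
      · exact Or.inr ⟨j, congrArg _ (hw j hj)⟩
  rw [Fvol, Fvol, hull v (fun _ _ ↦ rfl) hi hi',
    hull _ (fun j hj ↦ Function.update_of_ne hj _ _) (by simpa using h0) (by simpa using h0)]


/-- Let `S = {v₁,…,vₙ}` be an `(n,k)`-uframe with `n > k`, and suppose `vᵢ` lies in the
convex hull of `{±vⱼ : j ≠ i}`. Let `S̃` be the frame obtained by replacing `vᵢ` with `0`,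
and let `B = B_{S̃} = A_{S̃}^{-1/2}` (characterized as a symmetric positive definite
operator with `B ∘ B ∘ A_{S̃} = id`). Then `vol(conv{±vⱼ}) ≤ vol(conv{±B ṽⱼ})`, with
equality if and only if `vᵢ = 0`. -/
theorem vol_le_of_replace_zero {n k : ℕ} (hk : 0 < k) (hkn : k < n)
    (v : Fin n → EuclideanSpace ℝ (Fin k)) (hv : IsUframe v) (i : Fin n)
    (hi : v i ∈ convexHull ℝ {y | ∃ j, j ≠ i ∧ (y = v j ∨ y = -v j)})
    (B : EuclideanSpace ℝ (Fin k) →ₗ[ℝ] EuclideanSpace ℝ (Fin k))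
    (hBsym : ∀ x y, ⟪B x, y⟫ = ⟪x, B y⟫)
    (hBpos : ∀ x, x ≠ 0 → 0 < ⟪B x, x⟫)
    (hBB : ∀ x, B (B (frameOp (Function.update v i 0) x)) = x) :
    Fvol v ≤ Fvol (fun j => B (Function.update v i 0 j)) ∧
    (Fvol v = Fvol (fun j => B (Function.update v i 0 j)) ↔ v i = 0) := by
  have hdet : LinearMap.det B ^ 2 * (1 - ‖v i‖ ^ 2) = 1 := by
    have hcomp : B ∘ₗ B ∘ₗ frameOp (Function.update v i 0) = LinearMap.id := LinearMap.ext hBB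
    have h := congrArg LinearMap.det hcomp
    rw [LinearMap.det_comp, LinearMap.det_comp, hv.frameOp_update_zero,
      LinearMap.transvection.det, LinearMap.det_id, innerₛₗ_apply_apply, inner_neg_right,
      real_inner_self_eq_norm_sq] at h
    linear_combination h
  have hdet_ge : 1 ≤ |LinearMap.det B| := by
    rw [← one_le_sq_iff_one_le_abs]
    nlinarith [mul_nonneg (sq_nonneg (LinearMap.det B)) (sq_nonneg ‖v i‖)]
  rw [Fvol_comp_linearMap, Fvol_update_zero hi]
  refine ⟨le_mul_of_one_le_left' (ENNReal.one_le_ofReal.2 hdet_ge), fun h ↦ ?_, fun h ↦ ?_⟩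
  · have h1 : ENNReal.ofReal |LinearMap.det B| = 1 :=
      (ENNReal.mul_left_inj (hv.Fvol_ne_zero i) (Fvol_ne_top v)).1 (by rw [one_mul]; exact h.symm)
    rw [ENNReal.ofReal_eq_one] at h1
    rw [← sq_abs, h1] at hdet
    have h2 : ‖v i‖ ^ 2 = 0 := by linarith
    simpa using h2
  · have h1 : |LinearMap.det B| = 1 := by
      rw [← pow_eq_one_iff_of_nonneg (abs_nonneg _) two_ne_zero, sq_abs]
      simpa [h] using hdet
    rw [h1, ENNReal.ofReal_one, one_mul]
end

section
/- Let V(n,k) denote the supremum of F(S) over all (n,k)-uframes S. Then for all n ≥ k ≥ 2, V(n,k) ≤ V(k³, k). -/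
open MeasureTheory
open scoped RealInnerProductSpace ENNReal

/-- `V(n,k)`: the supremum of `F(S)` over all `(n,k)`-uframes `S`. -/
noncomputable def Vmax (n k : ℕ) : ℝ≥0∞ :=
  ⨆ (v : Fin n → EuclideanSpace ℝ (Fin k)) (_ : IsUframe v), Fvol v

/-- A chord of a symmetric convex set is at most as long as the parallel central chord. -/
lemma chord_volume_le {E : Type*} [NormedAddCommGroup E] [InnerProductSpace ℝ E]
    {K : Set E} (hconv : Convex ℝ K) (hsymm : ∀ x ∈ K, -x ∈ K) {e : E} {a : ℝ}
    (ha : ∀ t : ℝ, t • e ∈ K → t ≤ a) (y : E) :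
    volume {s : ℝ | s • e + y ∈ K} ≤ ENNReal.ofReal (2 * a) := by
  refine (Real.volume_le_diam _).trans (Metric.ediam_le ?_)
  have key : ∀ s t : ℝ, s • e + y ∈ K → t • e + y ∈ K → s - t ≤ 2 * a := by
    intro s t hs ht
    have := hconv hs (hsymm _ ht) (a := 1/2) (b := 1/2) (by norm_num) (by norm_num) (by norm_num)
    have h2 := ha ((s - t) / 2) (by convert! this using 1; module)
    linarith
  intro s hs t ht
  rw [edist_dist, Real.dist_eq]
  apply ENNReal.ofReal_le_ofReal
  rw [abs_le]
  exact ⟨by linarith [key t s ht hs], key s t hs ht⟩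

lemma lintegral_one_sub_abs_pow (d : ℕ) :
    ENNReal.ofReal (2 / (d + 1)) ≤
      ∫⁻ s in Set.Icc (-1 : ℝ) 1, ENNReal.ofReal ((1 - |s|) ^ d) := by
  have hc : Continuous fun s : ℝ => (1 - |s|) ^ d := by fun_prop
  rw [← ofReal_integral_eq_lintegral_ofReal hc.continuousOn.integrableOn_Icc]
  · rw [integral_Icc_eq_integral_Ioc, ← intervalIntegral.integral_of_le (by norm_num)]
    rw [← intervalIntegral.integral_add_adjacent_intervals (b := 0) (hc.intervalIntegrable _ _)
      (hc.intervalIntegrable _ _)]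
    have h1 : ∫ s in (-1 : ℝ)..0, (1 - |s|) ^ d = ∫ s in (-1 : ℝ)..0, (s + 1) ^ d := by
      apply intervalIntegral.integral_congr
      intro s hs
      rw [Set.uIcc_of_le (by norm_num)] at hs
      simp only [abs_of_nonpos hs.2]
      ring
    have h2 : ∫ s in (0 : ℝ)..1, (1 - |s|) ^ d = ∫ s in (0 : ℝ)..1, (1 - s) ^ d := by
      apply intervalIntegral.integral_congr
      intro s hs
      rw [Set.uIcc_of_le (by norm_num)] at hs
      simp only [abs_of_nonneg hs.1]
    rw [h1, h2, intervalIntegral.integral_comp_add_right (fun s => s ^ d),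
      intervalIntegral.integral_comp_sub_left (fun s => s ^ d)]
    simp only [integral_pow]
    apply ENNReal.ofReal_le_ofReal
    norm_num
    apply le_of_eq; field_simp; norm_num
  · filter_upwards [ae_restrict_mem measurableSet_Icc] with s hs
    have := abs_le.2 hs
    exact pow_nonneg (by linarith) _

/-- A symmetric convex body `K` whose half-width along the unit vector `e` is at most `1 / dim E`
has no larger volume than any convex body containing `±e` and the projection of `K` to `e⊥`. -/
lemma volume_le_of_orthogonal_projection {E : Type*} [NormedAddCommGroup E]
    [InnerProductSpace ℝ E] [FiniteDimensional ℝ E] [MeasurableSpace E] [BorelSpace E]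
    (μ : Measure E) [μ.IsAddHaarMeasure] {d : ℕ} (hd : Module.finrank ℝ E = d + 1)
    {K L : Set E} (hKc : IsCompact K) (hK : Convex ℝ K) (hKsymm : ∀ x ∈ K, -x ∈ K)
    (hLc : IsCompact L) (hL : Convex ℝ L) {e : E} (he : ‖e‖ = 1) (heL : e ∈ L) (heL' : -e ∈ L)
    {a : ℝ} (ha : ∀ t : ℝ, t • e ∈ K → t ≤ a) (had : a ≤ 1 / (d + 1))
    (hproj : ∀ x ∈ K, x - ⟪e, x⟫ • e ∈ L) : μ K ≤ μ L := by
  have he0 : e ≠ 0 := by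
    rintro rfl
    simp at he
  have : Fact (Module.finrank ℝ E = d + 1) := ⟨hd⟩
  set G := (Submodule.span ℝ {e})ᗮ with hG
  have hGd : Module.finrank ℝ G = d := Submodule.finrank_orthogonal_span_singleton he0
  have hGe : ∀ y : G, ⟪e, (y : E)⟫ = 0 := fun y =>
    Submodule.mem_orthogonal_singleton_iff_inner_right.mp y.2
  let f : ℝ × G →ₗ[ℝ] E := (LinearMap.toSpanSingleton ℝ E e).coprod G.subtype
  have hf : ∀ s y, f (s, y) = s • e + (y : E) := fun s y => by simp [f]
  have hinj : Function.Injective f := by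
    rw [← LinearMap.ker_eq_bot, LinearMap.ker_eq_bot']
    rintro ⟨s, y⟩ h
    rw [hf] at h
    have h1 : s = 0 := by
      have := congrArg (fun x => ⟪e, x⟫) h
      simpa [inner_add_right, inner_smul_right, hGe, he0] using this
    simp only [h1, zero_smul, zero_add, ZeroMemClass.coe_eq_zero] at h
    simp [h1, h]
  have hdim : Module.finrank ℝ (ℝ × G) = Module.finrank ℝ E := by
    rw [Module.finrank_prod, hGd, hd, Module.finrank_self, add_comm]
  let φ : (ℝ × G) ≃L[ℝ] E :=
    (LinearEquiv.ofInjectiveOfFinrankEq f hinj hdim).toContinuousLinearEquiv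
  have hφ : ∀ s y, φ (s, y) = s • e + (y : E) := hf
  let ν : Measure E := (volume : Measure (ℝ × G)).map φ
  have : ν.IsAddHaarMeasure := φ.isAddHaarMeasure_map (volume.prod volume)
  have hμν : μ = Measure.addHaarScalarFactor μ ν • ν := Measure.isAddLeftInvariant_eq_smul μ ν
  rw [hμν, Measure.smul_apply, Measure.smul_apply]
  refine smul_le_smul_of_nonneg_left ?_ zero_le
  have hν : ∀ s : Set E, ν s = (volume : Measure (ℝ × G)) (φ ⁻¹' s) := fun s =>
    φ.toHomeomorph.toMeasurableEquiv.map_apply s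
  have hmeas : ∀ {s : Set E}, IsCompact s → MeasurableSet (φ ⁻¹' s) := fun hs =>
    hs.measurableSet.preimage φ.continuous.measurable
  rw [hν, hν, Measure.volume_eq_prod]
  set B : Set G := Prod.snd '' (φ ⁻¹' K) with hB
  have hBc : IsCompact B := by
    refine IsCompact.image ?_ continuous_snd
    exact φ.toHomeomorph.isCompact_preimage.2 hKc
  have hBL : ∀ y ∈ B, (y : E) ∈ L := by
    rintro _ ⟨⟨s, y⟩, hy, rfl⟩
    have := hproj _ hy
    rw [hφ] at this
    simpa [inner_add_right, inner_smul_right, hGe, he] using this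
  calc (volume.prod volume) (φ ⁻¹' K)
      = ∫⁻ y : G, volume {s : ℝ | s • e + (y : E) ∈ K} := by
        rw [Measure.prod_apply_symm (hmeas hKc)]
        rfl
    _ ≤ ∫⁻ y : G, B.indicator (fun _ => ENNReal.ofReal (2 * a)) y := by
        refine lintegral_mono fun y => ?_
        by_cases hy : y ∈ B
        · rw [Set.indicator_of_mem hy]
          exact chord_volume_le hK hKsymm ha y
        · rw [Set.indicator_of_notMem hy]
          have : {s : ℝ | s • e + (y : E) ∈ K} = ∅ := by
            ext s
            simp only [Set.mem_ofPred_eq, Set.mem_empty_iff_false, iff_false]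
            exact fun hs => hy ⟨(s, y), hs, rfl⟩
          simp [this]
    _ = ENNReal.ofReal (2 * a) * volume B := lintegral_indicator_const hBc.measurableSet _
    _ ≤ ENNReal.ofReal (2 / (d + 1)) * volume B := by
        gcongr
        calc 2 * a ≤ 2 * (1 / (d + 1)) := by gcongr
          _ = _ := by ring
    _ ≤ (∫⁻ s in Set.Icc (-1 : ℝ) 1, ENNReal.ofReal ((1 - |s|) ^ d)) * volume B := by
        gcongr
        exact lintegral_one_sub_abs_pow d
    _ = ∫⁻ s in Set.Icc (-1 : ℝ) 1, ENNReal.ofReal ((1 - |s|) ^ d) * volume B := by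
        rw [lintegral_mul_const' _ _ hBc.measure_lt_top.ne]
    _ ≤ ∫⁻ s in Set.Icc (-1 : ℝ) 1, volume {y : G | s • e + (y : E) ∈ L} := by
        refine setLIntegral_mono' measurableSet_Icc fun s hs => ?_
        have hs1 := abs_le.2 hs
        rw [← hGd, ← abs_of_nonneg (pow_nonneg (sub_nonneg.2 hs1) (Module.finrank ℝ G)),
          ← Measure.addHaar_smul]
        refine measure_mono ?_
        rintro _ ⟨y, hy, rfl⟩
        have h1 : ∃ z ∈ L, |s| • z = s • e := by
          rcases abs_choice s with h | h
          · exact ⟨e, heL, by rw [h]⟩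
          · exact ⟨-e, heL', by rw [h]; module⟩
        obtain ⟨z, hz, hze⟩ := h1
        have := hL hz (hBL y hy) (abs_nonneg s) (sub_nonneg.2 hs1) (by ring)
        rw [hze] at this
        simpa using this
    _ ≤ ∫⁻ s : ℝ, volume {y : G | s • e + (y : E) ∈ L} := setLIntegral_le_lintegral _ _
    _ = (volume.prod volume) (φ ⁻¹' L) := by
        rw [Measure.prod_apply (hmeas hLc)]
        rfl

/-- The linear map that scales by `c` along the unit vector `e` and fixes `e⊥`. -/
noncomputable def axisStretch {E : Type*} [NormedAddCommGroup E] [InnerProductSpace ℝ E]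
    (e : E) (c : ℝ) : E →ₗ[ℝ] E :=
  LinearMap.transvection (innerₛₗ ℝ e) ((c - 1) • e)

lemma axisStretch_apply {E : Type*} [NormedAddCommGroup E] [InnerProductSpace ℝ E]
    (e : E) (c : ℝ) (x : E) : axisStretch e c x = x + (⟪e, x⟫ * (c - 1)) • e := by
  simp [axisStretch, LinearMap.transvection.apply, smul_smul]

lemma det_axisStretch {E : Type*} [NormedAddCommGroup E] [InnerProductSpace ℝ E]
    [FiniteDimensional ℝ E] {e : E} (he : ‖e‖ = 1) (c : ℝ) :
    LinearMap.det (axisStretch e c) = c := by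
  simp [axisStretch, LinearMap.transvection.det, he]

lemma inner_axisStretch {E : Type*} [NormedAddCommGroup E] [InnerProductSpace ℝ E]
    (e : E) (c : ℝ) (x y : E) : ⟪axisStretch e c x, y⟫ = ⟪x, axisStretch e c y⟫ := by
  simp only [axisStretch_apply, inner_add_left, inner_add_right, inner_smul_left,
    inner_smul_right, real_inner_comm e x, RCLike.conj_to_real]
  ring

namespace IsUframe

variable {n k : ℕ} {v : Fin n → EuclideanSpace ℝ (Fin k)}

lemma sum_inner_sq (hv : IsUframe v) (x : EuclideanSpace ℝ (Fin k)) :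
    ∑ i, ⟪v i, x⟫ ^ 2 = ‖x‖ ^ 2 := by
  have h := congrArg (fun y => ⟪y, x⟫) (hv x)
  simpa [sum_inner, inner_smul_left, ← sq, real_inner_self_eq_norm_sq] using h

lemma sum_norm_sq (hv : IsUframe v) : ∑ i, ‖v i‖ ^ 2 = k := by
  let b := EuclideanSpace.basisFun (Fin k) ℝ
  calc ∑ i, ‖v i‖ ^ 2 = ∑ i, ∑ j, ⟪v i, b j⟫ ^ 2 := by
        refine Finset.sum_congr rfl fun i _ => ?_
        rw [← b.sum_sq_norm_inner_left (v i)]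
        simp
    _ = ∑ j, ∑ i, ⟪v i, b j⟫ ^ 2 := Finset.sum_comm
    _ = k := by simp [hv.sum_inner_sq]

lemma inner_eq_zero (hv : IsUframe v) {i j : Fin n} (hi : ‖v i‖ = 1) (hij : j ≠ i) :
    ⟪v j, v i⟫ = 0 := by
  have h := hv.sum_inner_sq (v i)
  rw [← Finset.add_sum_erase _ _ (Finset.mem_univ i), real_inner_self_eq_norm_sq, hi] at h
  have h0 : ∑ j ∈ Finset.univ.erase i, ⟪v j, v i⟫ ^ 2 = 0 := by linarith
  rw [Finset.sum_eq_zero_iff_of_nonneg fun _ _ => sq_nonneg _] at h0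
  exact pow_eq_zero_iff two_ne_zero |>.1 (h0 j (by simp [hij]))

/-- Rescaling the `i`-th vector of a uframe and compensating by a stretch along it gives a uframe. -/
lemma update_axisStretch (hv : IsUframe v) {i : Fin n} {e : EuclideanSpace ℝ (Fin k)}
    (he : ‖e‖ = 1) {a b c : ℝ} (hi : v i = a • e) (habc : c ^ 2 * (1 - a ^ 2) + b ^ 2 = 1) :
    IsUframe (Function.update (fun j => axisStretch e c (v j)) i (b • e)) := by
  intro x
  rw [← Finset.add_sum_erase _ _ (Finset.mem_univ i)]
  have h1 : ∑ j ∈ Finset.univ.erase i,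
      ⟪Function.update (fun j => axisStretch e c (v j)) i (b • e) j, x⟫ •
        Function.update (fun j => axisStretch e c (v j)) i (b • e) j =
      axisStretch e c (∑ j ∈ Finset.univ.erase i, ⟪v j, axisStretch e c x⟫ • v j) := by
    rw [map_sum]
    refine Finset.sum_congr rfl fun j hj => ?_
    rw [Function.update_of_ne (Finset.ne_of_mem_erase hj), map_smul, inner_axisStretch]
  have h2 : ∑ j ∈ Finset.univ.erase i, ⟪v j, axisStretch e c x⟫ • v j =
      axisStretch e c x - ⟪v i, axisStretch e c x⟫ • v i := by
    rw [eq_sub_iff_add_eq', Finset.add_sum_erase _ (fun j => ⟪v j, axisStretch e c x⟫ • v j)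
      (Finset.mem_univ i)]
    exact hv _
  have hee : ⟪e, e⟫ = 1 := by rw [real_inner_self_eq_norm_sq, he, one_pow]
  rw [h1, h2, hi, Function.update_self]
  simp only [axisStretch_apply, inner_add_right, inner_sub_right, inner_smul_left,
    inner_smul_right, hee, RCLike.conj_to_real]
  have : (⟪e, x⟫ * (c ^ 2 * (1 - a ^ 2) + b ^ 2 - 1)) • e = 0 := by simp [habc]
  rw [← sub_eq_zero, ← this]
  module

end IsUframe

/-- The symmetric convex hull `conv{±v₁,…,±vₙ}`. -/
def symmHull {ι E : Type*} [AddCommGroup E] [Module ℝ E] (v : ι → E) : Set E :=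
  convexHull ℝ (Set.range v ∪ Set.range fun i => -v i)

section symmHull

variable {ι E : Type*} [AddCommGroup E] [Module ℝ E]

lemma convex_symmHull (v : ι → E) : Convex ℝ (symmHull v) := convex_convexHull ℝ _

lemma mem_symmHull (v : ι → E) (i : ι) : v i ∈ symmHull v :=
  subset_convexHull ℝ _ (Or.inl ⟨i, rfl⟩)

lemma neg_mem_symmHull {v : ι → E} {x : E} (hx : x ∈ symmHull v) : -x ∈ symmHull v := by
  have h : -(Set.range v ∪ Set.range fun i => -v i) = Set.range v ∪ Set.range fun i => -v i := by
    ext y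
    simp [neg_eq_iff_eq_neg, or_comm]
  rw [← Set.mem_neg, symmHull, ← convexHull_neg, h]
  exact hx

lemma symmHull_subset {v : ι → E} {s : Set E} (hs : Convex ℝ s) (hneg : ∀ x ∈ s, -x ∈ s)
    (hv : ∀ i, v i ∈ s) : symmHull v ⊆ s := by
  refine convexHull_min ?_ hs
  rintro _ (⟨i, rfl⟩ | ⟨i, rfl⟩)
  exacts [hv i, hneg _ (hv i)]

lemma image_symmHull {F : Type*} [AddCommGroup F] [Module ℝ F] (T : E →ₗ[ℝ] F) (v : ι → E) :
    T '' symmHull v = symmHull fun i => T (v i) := by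
  rw [symmHull, LinearMap.image_convexHull, symmHull, Set.image_union, ← Set.range_comp,
    ← Set.range_comp]
  simp [Function.comp_def]

lemma isCompact_symmHull {F : Type*} [Finite ι] [NormedAddCommGroup F] [NormedSpace ℝ F]
    (v : ι → F) : IsCompact (symmHull v) :=
  ((Set.finite_range _).union (Set.finite_range _)).isCompact_convexHull ℝ

lemma zero_mem_symmHull [Nonempty ι] (v : ι → E) : (0 : E) ∈ symmHull v := by
  obtain ⟨i⟩ := ‹Nonempty ι›
  have := convex_symmHull v (mem_symmHull v i) (neg_mem_symmHull (mem_symmHull v i))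
    (a := 1 / 2) (b := 1 / 2) (by norm_num) (by norm_num) (by norm_num)
  simpa using this

/-- A vector of the family outside the symmetric convex hull of the others is a boundary point. -/
lemma le_one_of_smul_mem_symmHull [DecidableEq ι] {v : ι → E} {i : ι}
    (hi : v i ∉ symmHull (Function.update v i 0)) {t : ℝ} (ht : t • v i ∈ symmHull v) :
    t ≤ 1 := by
  have : Nonempty ι := ⟨i⟩
  set K := symmHull (Function.update v i 0) with hK
  by_contra! h1
  have hsub : symmHull v ⊆ convexJoin ℝ (segment ℝ (v i) (-v i)) K := by
    have hK' : Convex ℝ K := convex_symmHull _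
    have h0 : (0 : E) ∈ segment ℝ (v i) (-v i) :=
      ⟨1 / 2, 1 / 2, by norm_num, by norm_num, by norm_num, by simp⟩
    refine convexHull_min ?_ ((convex_segment _ _).convexJoin hK')
    have key : ∀ j, j ≠ i → v j ∈ K := fun j hj => by
      simpa [hj] using mem_symmHull (Function.update v i 0) j
    have hl := subset_convexJoin_left (𝕜 := ℝ) (s := segment ℝ (v i) (-v i))
      ⟨_, zero_mem_symmHull (Function.update v i 0)⟩
    have hr := subset_convexJoin_right (𝕜 := ℝ) (t := K) ⟨_, h0⟩
    rintro _ (⟨j, rfl⟩ | ⟨j, rfl⟩)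
    · by_cases hj : j = i
      · exact hl (hj ▸ left_mem_segment ℝ _ _)
      · exact hr (key j hj)
    · by_cases hj : j = i
      · exact hl (hj ▸ right_mem_segment ℝ _ _)
      · exact hr (neg_mem_symmHull (key j hj))
  obtain ⟨x, hx, y, hy, p, q, hp, hq, hpq, h⟩ := mem_convexJoin.1 (hsub ht)
  obtain ⟨r, s, hr, hs, hrs, rfl⟩ := hx
  have hpos : 0 < t - p * (r - s) := by nlinarith
  have hqle : q ≤ t - p * (r - s) := by nlinarith
  have hv : v i = (q / (t - p * (r - s))) • y := by
    have h2 : (t - p * (r - s)) • v i = q • y := by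
      have : q • y = t • v i - p • (r • v i + s • -v i) := by rw [← h]; abel
      rw [this]
      module
    rw [div_eq_inv_mul, mul_smul, ← h2, smul_smul, inv_mul_cancel₀ hpos.ne', one_smul]
  apply hi
  rw [hv]
  exact (convex_symmHull _).smul_mem_of_zero_mem (zero_mem_symmHull _) hy
    ⟨div_nonneg hq hpos.le, (div_le_one hpos).2 hqle⟩

end symmHull

open Classical in
/-- The number of vectors of a family that are neither zero nor of unit length. -/
noncomputable def intermediateCount {ι E : Type*} [Fintype ι] [NormedAddCommGroup E]
    (v : ι → E) : ℕ :=
  (Finset.univ.filter fun i => v i ≠ 0 ∧ ‖v i‖ ≠ 1).card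

namespace IsUframe

variable {n k : ℕ} {v : Fin n → EuclideanSpace ℝ (Fin k)}

lemma intermediateCount_update_lt (hv : IsUframe v) {i : Fin n} {e : EuclideanSpace ℝ (Fin k)}
    {a b c : ℝ} (he : ‖e‖ = 1) (hi : v i = a • e) (ha0 : 0 < a) (ha1 : a < 1)
    (hb : b = 0 ∨ b = 1) :
    intermediateCount (Function.update (fun j => axisStretch e c (v j)) i (b • e)) <
      intermediateCount v := by
  classical
  have hni : ‖v i‖ = a := by rw [hi, norm_smul, he, mul_one, Real.norm_of_nonneg ha0.le]
  unfold intermediateCount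
  apply Finset.card_lt_card
  rw [Finset.ssubset_iff_of_subset]
  · refine ⟨i, ?_, ?_⟩
    · simp only [Finset.mem_filter, Finset.mem_univ, true_and]
      refine ⟨norm_ne_zero_iff.1 ?_, ?_⟩ <;> rw [hni]
      exacts [ha0.ne', ha1.ne]
    · rcases hb with rfl | rfl <;> simp [he]
  · intro j hj
    simp only [Finset.mem_filter, Finset.mem_univ, true_and] at hj ⊢
    by_cases hji : j = i
    · subst hji
      rcases hb with rfl | rfl <;> simp [he] at hj
    · rw [Function.update_of_ne hji] at hj
      refine ⟨fun h => hj.1 (by rw [h, map_zero]), fun h => hj.2 ?_⟩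
      have h1 := hv.inner_eq_zero h (Ne.symm hji)
      rw [hi, inner_smul_left, mul_eq_zero] at h1
      have h2 : ⟪e, v j⟫ = 0 := h1.resolve_left (by simpa using ha0.ne')
      rw [axisStretch_apply, h2, zero_mul, zero_smul, add_zero, h]

/-- A nonzero vector shorter than `1 / k` can be deleted or made a unit vector orthogonal to the
others without decreasing the volume. -/
lemma exists_fvol_le_of_norm_lt (hk : 2 ≤ k) (hv : IsUframe v) {i : Fin n} (hi0 : v i ≠ 0)
    (hik : ‖v i‖ < 1 / k) :
    ∃ w : Fin n → EuclideanSpace ℝ (Fin k), IsUframe w ∧ Fvol v ≤ Fvol w ∧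
      intermediateCount w < intermediateCount v := by
  have : Nonempty (Fin n) := ⟨i⟩
  set a := ‖v i‖ with ha
  set e := a⁻¹ • v i with he_def
  have ha0 : 0 < a := norm_pos_iff.2 hi0
  have hk' : (2 : ℝ) ≤ k := by exact_mod_cast hk
  have ha1 : a < 1 := hik.trans_le (by rw [div_le_one] <;> linarith)
  have hi : v i = a • e := by rw [he_def, smul_smul, mul_inv_cancel₀ ha0.ne', one_smul]
  have he : ‖e‖ = 1 := by
    rw [he_def, norm_smul, norm_inv, Real.norm_of_nonneg ha0.le, ← ha, inv_mul_cancel₀ ha0.ne']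
  by_cases hK : v i ∈ symmHull (Function.update v i 0)
  · have hpos : 0 < 1 - a ^ 2 := by nlinarith
    set c := (√(1 - a ^ 2))⁻¹ with hc
    have hc1 : 1 ≤ c := by
      rw [hc, one_le_inv₀ (Real.sqrt_pos.2 hpos), Real.sqrt_le_iff]
      constructor <;> nlinarith
    have hc2 : c ^ 2 * (1 - a ^ 2) + 0 ^ 2 = 1 := by
      rw [hc, inv_pow, Real.sq_sqrt hpos.le, inv_mul_cancel₀ hpos.ne']
      norm_num
    refine ⟨_, hv.update_axisStretch he hi hc2, ?_,
      hv.intermediateCount_update_lt he hi ha0 ha1 (Or.inl rfl)⟩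
    have h1 : (Function.update (fun j => axisStretch e c (v j)) i ((0 : ℝ) • e)) =
        fun j => axisStretch e c (Function.update v i 0 j) := by
      ext1 j
      by_cases hj : j = i
      · subst hj
        simp
      · simp [hj]
    change volume (symmHull v) ≤ volume (symmHull _)
    rw [h1, ← image_symmHull, Measure.addHaar_image_linearMap, det_axisStretch he]
    calc volume (symmHull v) ≤ volume (symmHull (Function.update v i 0)) := by
          refine measure_mono (symmHull_subset (convex_symmHull _)
            (fun _ => neg_mem_symmHull) fun j => ?_)
          by_cases hj : j = i
          · exact hj ▸ hK
          · simpa [hj] using mem_symmHull (Function.update v i 0) j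
      _ ≤ _ := le_mul_of_one_le_left' (by
          rw [abs_of_nonneg (by linarith)]
          simpa using ENNReal.ofReal_le_ofReal hc1)
  · refine ⟨_, hv.update_axisStretch he hi (c := 0) (b := 1) (by norm_num), ?_,
      hv.intermediateCount_update_lt he hi ha0 ha1 (Or.inr rfl)⟩
    set w := Function.update (fun j => axisStretch e 0 (v j)) i ((1 : ℝ) • e) with hw
    have hwi : w i = e := by simp [hw]
    have hee : ⟪e, e⟫ = 1 := by rw [real_inner_self_eq_norm_sq, he, one_pow]
    obtain ⟨d, rfl⟩ : ∃ d, k = d + 1 := ⟨k - 1, by omega⟩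
    refine volume_le_of_orthogonal_projection volume (d := d) (by simp) (isCompact_symmHull v)
      (convex_symmHull v) (fun _ => neg_mem_symmHull) (isCompact_symmHull w) (convex_symmHull w)
      he (hwi ▸ mem_symmHull w i) (neg_mem_symmHull (hwi ▸ mem_symmHull w i)) (a := a) ?_
      (by push_cast at hik; exact hik.le) ?_
    · intro t ht
      have : (t / a) • v i ∈ symmHull v := by
        rwa [hi, smul_smul, div_mul_cancel₀ _ ha0.ne']
      exact (div_le_one ha0).1 (le_one_of_smul_mem_symmHull hK this)
    · have himg : axisStretch e 0 '' symmHull v ⊆ symmHull w := by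
        rw [image_symmHull]
        refine symmHull_subset (convex_symmHull _) (fun _ => neg_mem_symmHull) fun j => ?_
        by_cases hj : j = i
        · subst hj
          have : axisStretch e 0 (v j) = 0 := by
            rw [hi, map_smul, axisStretch_apply, hee]
            simp
          rw [this]
          exact zero_mem_symmHull w
        · simpa [hw, hj] using mem_symmHull w j
      intro x hx
      have := himg ⟨x, hx, rfl⟩
      rw [axisStretch_apply] at this
      convert! this using 1
      module

lemma exists_fvol_le_of_forall_norm_ge (hk : 2 ≤ k) (hv : IsUframe v) :
    ∃ w : Fin n → EuclideanSpace ℝ (Fin k), IsUframe w ∧ Fvol v ≤ Fvol w ∧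
      ∀ i, w i ≠ 0 → 1 / k ≤ ‖w i‖ := by
  induction h : intermediateCount v using Nat.strong_induction_on generalizing v with
  | _ m ih =>
    by_cases hall : ∀ i, v i ≠ 0 → 1 / k ≤ ‖v i‖
    · exact ⟨v, hv, le_rfl, hall⟩
    · push Not at hall
      obtain ⟨i, hi0, hi⟩ := hall
      obtain ⟨w, hw, hvw, hlt⟩ := hv.exists_fvol_le_of_norm_lt hk hi0 hi
      obtain ⟨u, hu, hwu, hun⟩ := ih _ (h ▸ hlt) hw rfl
      exact ⟨u, hu, hvw.trans hwu, hun⟩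

open Classical in
lemma card_ne_zero_le (hk : 0 < k) (hv : IsUframe v) (hnorm : ∀ i, v i ≠ 0 → 1 / k ≤ ‖v i‖) :
    (Finset.univ.filter fun i => v i ≠ 0).card ≤ k ^ 3 := by
  have hk' : (0 : ℝ) < k := by exact_mod_cast hk
  have h : ((Finset.univ.filter fun i => v i ≠ 0).card : ℝ) * (1 / k) ^ 2 ≤ k := by
    rw [← nsmul_eq_mul]
    calc _ ≤ ∑ i with v i ≠ 0, ‖v i‖ ^ 2 := by
          refine Finset.card_nsmul_le_sum _ _ _ fun i hi => ?_
          have := hnorm i (Finset.mem_filter.1 hi).2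
          gcongr
      _ ≤ ∑ i, ‖v i‖ ^ 2 :=
          Finset.sum_le_sum_of_subset_of_nonneg (Finset.filter_subset _ _)
            fun _ _ _ => sq_nonneg _
      _ = k := hv.sum_norm_sq
  rw [div_pow, one_pow, mul_one_div, div_le_iff₀ (by positivity)] at h
  have h' : ((Finset.univ.filter fun i => v i ≠ 0).card : ℝ) ≤ (k : ℝ) ^ 3 := by
    linarith
  exact_mod_cast h'

open Classical in
lemma fvol_le_Vmax_of_card_le (hv : IsUframe v) {m : ℕ} (hm : 0 < m)
    (hcard : (Finset.univ.filter fun i => v i ≠ 0).card ≤ m) : Fvol v ≤ Vmax m k := by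
  have : Nonempty (Fin m) := ⟨⟨0, hm⟩⟩
  have hcard' : Fintype.card {i // v i ≠ 0} ≤ Fintype.card (Fin m) := by
    rwa [Fintype.card_subtype, Fintype.card_fin]
  obtain ⟨f⟩ := Function.Embedding.nonempty_of_card_le hcard'
  let w : Fin m → EuclideanSpace ℝ (Fin k) :=
    Function.extend f (fun i : {i // v i ≠ 0} => v i) 0
  have hwf : ∀ i, w (f i) = v i := fun i => f.injective.extend_apply _ _ i
  have hw : IsUframe w := by
    intro x
    calc ∑ j, ⟪w j, x⟫ • w j = ∑ i : {i // v i ≠ 0}, ⟪v i, x⟫ • v i := by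
          refine (Fintype.sum_of_injective f f.injective _ _ (fun j hj => ?_) fun i => ?_).symm
          · have : w j = 0 := Function.extend_apply' _ _ _ (by simpa using hj)
            simp [this]
          · rw [hwf]
      _ = ∑ i, ⟪v i, x⟫ • v i := by
          refine Fintype.sum_of_injective Subtype.val Subtype.val_injective _ _
            (fun i hi => ?_) fun _ => rfl
          have : v i = 0 := by simpa using hi
          simp [this]
      _ = x := hv x
  refine le_trans (measure_mono (?_ : symmHull v ⊆ symmHull w))
    (le_iSup₂ (f := fun (v : Fin m → EuclideanSpace ℝ (Fin k)) (_ : IsUframe v) => Fvol v) w hw)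
  refine symmHull_subset (convex_symmHull _) (fun _ => neg_mem_symmHull) fun i => ?_
  by_cases hi : v i = 0
  · exact hi ▸ zero_mem_symmHull w
  · exact hwf ⟨i, hi⟩ ▸ mem_symmHull w (f ⟨i, hi⟩)

end IsUframe

/-- For all `n ≥ k ≥ 2`, `V(n,k) ≤ V(k³, k)`. -/
theorem Vmax_le (n k : ℕ) (hk : 2 ≤ k) (hkn : k ≤ n) :
    Vmax n k ≤ Vmax (k ^ 3) k := by
  refine iSup₂_le fun v hv => ?_
  obtain ⟨w, hw, hvw, hnorm⟩ := hv.exists_fvol_le_of_forall_norm_ge hk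
  exact hvw.trans (hw.fvol_le_Vmax_of_card_le (by positivity)
    (hw.card_ne_zero_le (by omega) hnorm))
end
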